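/- Let W ∈ 𝒲([3],[2]) be a channel with W δ_1 ≠ W δ_2 and W δ_3 = λ W δ_1 + (1−λ) W δ_2 for some λ ∈ (0,1). Then the three vectors (W δ_1)⊗(W δ_1), (W δ_2)⊗(W δ_2), (W δ_3)⊗(W δ_3) are linearly independent in the space of functions [2]² → ℝ; consequently W⊗W is invertible as a map from 𝔓^{(2)}([3]) to its image in 𝔓([2]²). -/

import Mathlib

open scoped BigOperators

/-- `p` is a probability distribution on `Fin L`. -/
def probDist {L : ℕ} (p : Fin L → ℝ) : Prop :=
  (∀ i, 0 ≤ p i) ∧ ∑ i, p i = 1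

/-- `p` is a probability distribution on `Fin L` with all entries strictly positive. -/
def probPos {L : ℕ} (p : Fin L → ℝ) : Prop :=
  (∀ i, 0 < p i) ∧ ∑ i, p i = 1

/-- `p^{(K)}`: the function on `[L]^K` equal to `p i` on the constant tuple `(i,…,i)`
and `0` elsewhere. -/
def diagEmbed {L : ℕ} (p : Fin L → ℝ) (K : ℕ) : (Fin K → Fin L) → ℝ :=
  fun y => ∑ i, if (∀ k, y k = i) then p i else 0

/-- The action of `X_1 ⊗ … ⊗ X_K` on functions `[L]^K → ℝ`. -/
def tensorAct {L L' K : ℕ} (X : Fin K → Matrix (Fin L') (Fin L) ℝ)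
    (v : (Fin K → Fin L) → ℝ) : (Fin K → Fin L') → ℝ :=
  fun y => ∑ x : Fin K → Fin L, v x * ∏ k, X k (y k) (x k)

/-- A channel from `[L]` to `[L']`: an `L' × L` column-stochastic matrix. -/
def isChannel {L L' : ℕ} (W : Matrix (Fin L') (Fin L) ℝ) : Prop :=
  (∀ i j, 0 ≤ W i j) ∧ ∀ j, ∑ i, W i j = 1

lemma tensorAct_diagEmbed {L L' K : ℕ} (X : Fin K → Matrix (Fin L') (Fin L) ℝ)
    (p : Fin L → ℝ) (y : Fin K → Fin L') :
    tensorAct X (diagEmbed p K) y = ∑ i, p i * ∏ k, X k (y k) i := by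
  have h_const (x : Fin K → Fin L) (i : Fin L) : (∀ k, x k = i) ↔ x = fun _ => i :=
    funext_iff.symm
  simp only [tensorAct, diagEmbed, h_const, Finset.sum_mul]
  rw [Finset.sum_comm]
  simp [ite_mul]

/-- Tensor squares of the columns of a channel to a binary alphabet are linearly independent
when the three columns have pairwise distinct first entries. -/
lemma linearIndependent_tensor_squares (W : Matrix (Fin 2) (Fin 3) ℝ) (hW : isChannel W)
    (h_inj : Function.Injective (W 0)) :
    LinearIndependent ℝ
      (fun i : Fin 3 => fun y : Fin 2 → Fin 2 => W (y 0) i * W (y 1) i) := by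
  rw [Fintype.linearIndependent_iff]
  intro c hc
  have h_row (j : Fin 3) : W 1 j = 1 - W 0 j := by
    have := hW.2 j
    rw [Fin.sum_univ_two] at this
    linarith
  have h00 := congrFun hc ![0, 0]
  have h01 := congrFun hc ![0, 1]
  have h11 := congrFun hc ![1, 1]
  simp [Fin.sum_univ_three, h_row] at h00 h01 h11
  have hs : c = 0 := by
    refine Matrix.eq_zero_of_vecMul_eq_zero (M := Matrix.vandermonde (W 0))
      (Matrix.det_vandermonde_ne_zero_iff.mpr h_inj) ?_
    ext j
    fin_cases j <;> simp [Matrix.vecMul, dotProduct, Fin.sum_univ_three, Matrix.vandermonde]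
    · linear_combination h00 + 2 * h01 + h11
    · linear_combination h00 + h01
    · linear_combination h00
  exact congrFun hs

theorem tensor_squares_independent_generic (W : Matrix (Fin 2) (Fin 3) ℝ)
    (hW : isChannel W) (lam : ℝ) (hlam : lam ∈ Set.Ioo (0 : ℝ) 1)
    (hcols : (fun a => W a 0) ≠ (fun a => W a 1))
    (hthird : ∀ a, W a 2 = lam * W a 0 + (1 - lam) * W a 1) :
    LinearIndependent ℝ
      (fun i : Fin 3 => fun y : Fin 2 → Fin 2 => W (y 0) i * W (y 1) i)
    ∧
    (∀ p p' : Fin 3 → ℝ, probDist p → probDist p' →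
      tensorAct (fun _ : Fin 2 => W) (diagEmbed p 2)
        = tensorAct (fun _ : Fin 2 => W) (diagEmbed p' 2) →
      p = p') := by
  have h01 : W 0 0 - W 0 1 ≠ 0 := by
    intro h
    have h0 := hW.2 0
    have h1 := hW.2 1
    rw [Fin.sum_univ_two] at h0 h1
    refine hcols (funext fun a => ?_)
    fin_cases a <;> simp <;> linarith
  have h02 : W 0 0 - W 0 2 ≠ 0 := by
    have : W 0 0 - W 0 2 = (1 - lam) * (W 0 0 - W 0 1) := by rw [hthird]; ring
    rw [this]
    exact mul_ne_zero (sub_pos.mpr hlam.2).ne' h01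
  have h12 : W 0 2 - W 0 1 ≠ 0 := by
    have : W 0 2 - W 0 1 = lam * (W 0 0 - W 0 1) := by rw [hthird]; ring
    rw [this]
    exact mul_ne_zero hlam.1.ne' h01
  have h_inj : Function.Injective (W 0) := by
    intro i j hij
    rw [sub_ne_zero] at h01 h02 h12
    fin_cases i <;> fin_cases j <;> first | rfl | exact absurd hij ‹_› | exact absurd hij.symm ‹_›
  have h_ind := linearIndependent_tensor_squares W hW h_inj
  refine ⟨h_ind, fun p p' _ _ h => ?_⟩
  rw [linearIndependent_iff_injective_fintypeLinearCombination] at h_ind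
  refine h_ind (funext fun y => ?_)
  have hy := congrFun h y
  simpa [tensorAct_diagEmbed, Fintype.linearCombination_apply, Fin.prod_univ_two] using hy
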